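/- arXiv:1710.08319 — 2 statements merged into one kernel-verified Lean document; each statement's English description precedes it below -/
import Mathlib

section
/- Let γ ∈ ℝ with sin γ ≠ 0, Δ = cos γ. For all φ, s ∈ ℂ, the Sutherland equation holds as an identity of linear operators on ℂ² ⊗ ℂ² ⊗ H_a: [h^{XXZ}, L₁(φ,s) L₂(φ,s)] = −2 sin γ ( L̃₁(φ,s) L₂(φ,s) − L₁(φ,s) L̃₂(φ,s) ), where L̃(φ,s) := ∂_φ L(φ,s) is the 2×2 matrix [[cos(φ + γ s^z_s), 0], [0, cos(φ − γ s^z_s)]] of diagonal auxiliary-space operators, and subscripts 1, 2 indicate the physical ℂ² factor on which the operator acts. -/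
/- STATEMENT 2: the Sutherland equation for the XXZ Lax operator,
as an identity of linear operators on ℂ² ⊗ ℂ² ⊗ H_a
(realized concretely as functions (Fin 2 × Fin 2) → H_a). -/

noncomputable section

open Matrix Kronecker

/-- The auxiliary space: finitely supported functions ℕ → ℂ. -/
abbrev Ha : Type := ℕ →₀ ℂ

/-- The linear operator on `Ha` sending the basis vector `|l⟩` to `v l`. -/
def ofBasis (v : ℕ → Ha) : Ha →ₗ[ℂ] Ha :=
  Finsupp.lsum ℂ fun l => LinearMap.toSpanSingleton ℂ Ha (v l)

/-- The q-number `[x]_q = (q^x - q^{-x})/(q - q^{-1})` for `q = exp(iγ)`. -/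
def qnum (γ : ℝ) (x : ℂ) : ℂ :=
  (Complex.exp (Complex.I * γ * x) - Complex.exp (-(Complex.I * γ * x))) /
    (Complex.exp (Complex.I * γ) - Complex.exp (-(Complex.I * γ)))

/-- `s⁺ = Σ_{k≥0} [k+1]_q |k⟩⟨k+1|`. -/
def Sp (γ : ℝ) : Ha →ₗ[ℂ] Ha :=
  ofBasis fun l =>
    match l with
    | 0 => 0
    | k + 1 => qnum γ ((k : ℂ) + 1) • Finsupp.single k 1

/-- `s⁻_s = Σ_{k≥0} [2s-k]_q |k+1⟩⟨k|`. -/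
def Sm (γ : ℝ) (s : ℂ) : Ha →ₗ[ℂ] Ha :=
  ofBasis fun k => qnum γ (2 * s - (k : ℂ)) • Finsupp.single (k + 1) 1

/-- Diagonal operator `Σ_k c(k) |k⟩⟨k|` on the auxiliary space. -/
def diagOp (c : ℕ → ℂ) : Ha →ₗ[ℂ] Ha :=
  ofBasis fun k => c k • Finsupp.single k 1

/-- An operator on `ι → Ha` ≅ ℂ^ι ⊗ H_a given by a matrix of auxiliary-space
operators. -/
def matOp {ι : Type} [Fintype ι] (A : ι → ι → (Ha →ₗ[ℂ] Ha)) :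
    (ι → Ha) →ₗ[ℂ] (ι → Ha) where
  toFun f i := ∑ j, A i j (f j)
  map_add' f g := by
    funext i
    simp [Finset.sum_add_distrib]
  map_smul' c f := by
    funext i
    simp [Finset.smul_sum]

/-- The operator given by the 2×2 matrix `M` of auxiliary operators, acting on
the first physical ℂ² factor (and the auxiliary space). -/
def leg1 (M : Matrix (Fin 2) (Fin 2) (Ha →ₗ[ℂ] Ha)) :
    (Fin 2 × Fin 2 → Ha) →ₗ[ℂ] (Fin 2 × Fin 2 → Ha) :=
  matOp fun p q => if p.2 = q.2 then M p.1 q.1 else 0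

/-- The operator given by the 2×2 matrix `M` of auxiliary operators, acting on
the second physical ℂ² factor (and the auxiliary space). -/
def leg2 (M : Matrix (Fin 2) (Fin 2) (Ha →ₗ[ℂ] Ha)) :
    (Fin 2 × Fin 2 → Ha) →ₗ[ℂ] (Fin 2 × Fin 2 → Ha) :=
  matOp fun p q => if p.1 = q.1 then M p.2 q.2 else 0

/-- A purely physical operator (a 4×4 scalar matrix acting trivially on the
auxiliary space). -/
def physOp (A : Matrix (Fin 2 × Fin 2) (Fin 2 × Fin 2) ℂ) :
    (Fin 2 × Fin 2 → Ha) →ₗ[ℂ] (Fin 2 × Fin 2 → Ha) :=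
  matOp fun p q => A p q • LinearMap.id

def pauliZ : Matrix (Fin 2) (Fin 2) ℂ := !![1, 0; 0, -1]
def pauliP : Matrix (Fin 2) (Fin 2) ℂ := !![0, 1; 0, 0]
def pauliM : Matrix (Fin 2) (Fin 2) ℂ := !![0, 0; 1, 0]

/-- The local XXZ Hamiltonian density
`h = 2(σ⁺⊗σ⁻ + σ⁻⊗σ⁺) + Δ σ^z⊗σ^z` with `Δ = cos γ`. -/
def hXXZ (γ : ℝ) : Matrix (Fin 2 × Fin 2) (Fin 2 × Fin 2) ℂ :=
  (2 : ℂ) • (pauliP ⊗ₖ pauliM + pauliM ⊗ₖ pauliP)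
    + (Real.cos γ : ℂ) • (pauliZ ⊗ₖ pauliZ)

/-- The XXZ R-matrix
`R(φ) = (sin φ/2)(h + cos γ 𝟙) − ((1+cos φ)/2) sin γ 𝟙 + ((1−cos φ)/2) sin γ σ^z⊗σ^z`. -/
def Rmat (γ : ℝ) (φ : ℂ) : Matrix (Fin 2 × Fin 2) (Fin 2 × Fin 2) ℂ :=
  (Complex.sin φ / 2) • (hXXZ γ + (Real.cos γ : ℂ) • (1 : Matrix (Fin 2 × Fin 2) (Fin 2 × Fin 2) ℂ))
    - ((1 + Complex.cos φ) / 2 * (Real.sin γ : ℂ)) • (1 : Matrix (Fin 2 × Fin 2) (Fin 2 × Fin 2) ℂ)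
    + ((1 - Complex.cos φ) / 2 * (Real.sin γ : ℂ)) • (pauliZ ⊗ₖ pauliZ)

/-- The XXZ Lax operator `L(φ,s)` as a 2×2 matrix of auxiliary-space operators:
`[[sin(φ + γ s^z), sin γ s⁻], [sin γ s⁺, sin(φ − γ s^z)]]`. -/
def LaxM (γ : ℝ) (φ s : ℂ) : Matrix (Fin 2) (Fin 2) (Ha →ₗ[ℂ] Ha) :=
  !![diagOp fun k => Complex.sin (φ + γ * (s - (k : ℂ))), (Real.sin γ : ℂ) • Sm γ s;
     (Real.sin γ : ℂ) • Sp γ, diagOp fun k => Complex.sin (φ - γ * (s - (k : ℂ)))]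

/-- The φ-derivative of the Lax operator:
`L̃(φ,s) = [[cos(φ + γ s^z), 0], [0, cos(φ − γ s^z)]]`. -/
def LaxTilde (γ : ℝ) (φ s : ℂ) : Matrix (Fin 2) (Fin 2) (Ha →ₗ[ℂ] Ha) :=
  !![diagOp fun k => Complex.cos (φ + γ * (s - (k : ℂ))), 0;
     0, diagOp fun k => Complex.cos (φ - γ * (s - (k : ℂ)))]

theorem ofBasis_single (v : ℕ → Ha) (k : ℕ) (c : ℂ) :
    ofBasis v (Finsupp.single k c) = c • v k := by
  simp [ofBasis]

theorem diagOp_single (d : ℕ → ℂ) (k : ℕ) (c : ℂ) :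
    diagOp d (Finsupp.single k c) = Finsupp.single k (d k * c) := by
  simp [diagOp, ofBasis_single, mul_comm]

theorem sin_qnum (γ : ℝ) (hγ : Real.sin γ ≠ 0) (x : ℂ) :
    (Real.sin γ : ℂ) * qnum γ x = Complex.sin (γ * x) := by
  have h1 : ∀ y : ℂ, Complex.exp (Complex.I * y) - Complex.exp (-(Complex.I * y))
      = 2 * Complex.I * Complex.sin y := by
    intro y
    rw [mul_comm Complex.I y, ← neg_mul, Complex.exp_mul_I, Complex.exp_mul_I,
      Complex.cos_neg, Complex.sin_neg]
    ring
  have h2 : Complex.sin γ ≠ 0 := by exact_mod_cast hγ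
  unfold qnum
  rw [mul_assoc, h1, h1, Complex.ofReal_sin]
  have := Complex.I_ne_zero
  field_simp

theorem B_single (γ : ℝ) (hγ : Real.sin γ ≠ 0) (s : ℂ) (k : ℕ) (c : ℂ) :
    ((Real.sin γ : ℂ) • Sm γ s) (Finsupp.single k c)
      = Finsupp.single (k + 1) (Complex.sin (γ * (2 * s - k)) * c) := by
  rw [← sin_qnum γ hγ]
  simp [Sm, ofBasis_single, -Finsupp.single_mul]
  ring_nf

theorem C_single_zero (γ : ℝ) (c : ℂ) :
    ((Real.sin γ : ℂ) • Sp γ) (Finsupp.single 0 c) = 0 := by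
  simp [Sp, ofBasis_single, -Finsupp.single_mul]

theorem C_single_succ (γ : ℝ) (hγ : Real.sin γ ≠ 0) (k : ℕ) (c : ℂ) :
    ((Real.sin γ : ℂ) • Sp γ) (Finsupp.single (k + 1) c)
      = Finsupp.single k (Complex.sin (γ * (k + 1)) * c) := by
  rw [← sin_qnum γ hγ]
  simp [Sp, ofBasis_single, -Finsupp.single_mul]
  ring_nf

theorem single_congr_aux (n : ℕ) (x y : ℂ) (h : x - y = 0) :
    (Finsupp.single n x : Ha) = Finsupp.single n y := by
  rw [sub_eq_zero.mp h]

theorem single_zero_aux (n : ℕ) (x : ℂ) (h : x = 0) :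
    (Finsupp.single n x : Ha) = 0 := by
  simp [h]

set_option maxHeartbeats 4000000 in
/-- The Sutherland equation
`[h^XXZ, L₁(φ,s)L₂(φ,s)] = −2 sin γ (L̃₁(φ,s)L₂(φ,s) − L₁(φ,s)L̃₂(φ,s))`. -/
theorem sutherland_equation (γ : ℝ) (hγ : Real.sin γ ≠ 0) (φ s : ℂ) :
    physOp (hXXZ γ) ∘ₗ (leg1 (LaxM γ φ s) ∘ₗ leg2 (LaxM γ φ s))
        - (leg1 (LaxM γ φ s) ∘ₗ leg2 (LaxM γ φ s)) ∘ₗ physOp (hXXZ γ)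
      = (-2 * (Real.sin γ : ℂ)) •
          (leg1 (LaxTilde γ φ s) ∘ₗ leg2 (LaxM γ φ s)
            - leg1 (LaxM γ φ s) ∘ₗ leg2 (LaxTilde γ φ s)) := by
  generalize hB : (Real.sin γ : ℂ) • Sm γ s = B
  generalize hC : (Real.sin γ : ℂ) • Sp γ = C
  have bB := B_single γ hγ s
  have bC0 := C_single_zero γ
  have bC := C_single_succ γ hγ
  rw [hB] at bB
  rw [hC] at bC0 bC
  unfold LaxM LaxTilde
  rw [hB, hC]
  refine LinearMap.pi_ext' fun q => Finsupp.lhom_ext' fun k => LinearMap.ext_ring ?_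
  funext p
  obtain ⟨p1, p2⟩ := p
  obtain ⟨q1, q2⟩ := q
  fin_cases p1 <;> fin_cases p2 <;> fin_cases q1 <;> fin_cases q2 <;>
    simp [physOp, leg1, leg2, matOp, hXXZ, pauliZ, pauliP, pauliM, Fintype.sum_prod_type,
      diagOp_single, bB, -Finsupp.single_mul] <;>
    rcases k with _ | k <;>
    (try simp [diagOp_single, bB, bC0, bC, -Finsupp.single_mul]) <;>
    (try simp only [← Finsupp.single_neg, ← Finsupp.single_add, ← Finsupp.single_sub,
      Finsupp.smul_single, smul_eq_mul]) <;>
    first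
      | (refine single_congr_aux _ _ _ ?_; ring1)
      | (refine single_zero_aux _ _ ?_; ring1)
      | (rw [← map_smul, Finsupp.smul_single, smul_eq_mul, mul_comm, sub_self])
      | (refine single_congr_aux _ _ _ ?_
         simp only [mul_sub, mul_add, mul_one, mul_left_comm (γ : ℂ) 2 s, Complex.sin_add,
           Complex.sin_sub, Complex.cos_add, Complex.cos_sub, Complex.sin_two_mul,
           Complex.cos_two_mul]
         have e1 := Complex.sin_sq_add_cos_sq γ
         have e2 := Complex.sin_sq_add_cos_sq φ
         have e3 := Complex.sin_sq_add_cos_sq (γ * s)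
         try have e4 := Complex.sin_sq_add_cos_sq (γ * k)
         clear bB bC0 bC hB hC
         grind)

end
end

section
/- Let ξ, ω, z, c₊, c₋ ∈ ℂ with ξ ≠ 0, ω ≠ 0, z ≠ 0, ξω ≠ 1. Define the 8×8 matrices Ŵ_s = e₁₁ ⊗ W_s(ξz, ω/z) + e₂₂ ⊗ W_s(ξ/z, ωz), Ŵ'_s = e₁₁ ⊗ W'_s(ξz, ω/z) + e₂₂ ⊗ W'_s(ξ/z, ωz), Ŝ = 𝟙₂ ⊗ S, and for k ∈ ℤ the matrices F̂^{(k)} = 𝟙₈ + e₁₂ ⊗ (c₊ z^k F₊ + c₋ z^{−k} F₋)/(ξω − 1), and analogously F̂'^{(k)}, Ĝ^{(k)}, Ĝ'^{(k)}, K̂^{(k)} (with 𝟙₈ replaced as appropriate) and L̂^{(k)} = (z e₁₁ + z^{−1} e₂₂) ⊗ 𝟙₄ + e₁₂ ⊗ (c₊ z^k L₊ + c₋ z^{−k} L₋)/(ξω − 1), where F₊, F₋, F'₊, F'₋, G₊, G₋, G'₊, G'₋, K₊, K₋, L₊, L₋ are the explicit 4×4 matrices of the first-orbital representation of the boundary-driven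 Rule 54 automaton. Then for all k ∈ ℤ and all s, s', s'' ∈ ℤ₂ the deformed bulk relations hold: K̂^{(k−1)} Ŵ_s Ŝ Ĝ^{(k)} Ŵ_{χ(s,s',s'')} F̂^{(k+1)} Ŵ'_{s''} = F̂'^{(k−1)} Ŵ_s Ĝ'^{(k)} Ŵ'_{s'} K̂^{(k+1)} Ŵ_{s''} Ŝ and Ĝ'^{(k−1)} Ŵ'_s F̂'^{(k)} Ŵ_{χ(s,s',s'')} L̂^{(k+1)} Ŵ'_{s''} Ŝ = L̂^{(k−1)} Ŵ'_s Ŝ F̂^{(k)} Ŵ'_{s'} Ĝ^{(k+1)} Ŵ_{s''}. -/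
/- STATEMENT 14: the deformed bulk cancellation relations for the first
(leading decay mode) orbital of the boundary-driven Rule 54 automaton,
with the explicit 8×8 representation. -/

noncomputable section

open Matrix Kronecker

/-- The Rule 54 local update function. -/
def chi (w n e : ZMod 2) : ZMod 2 := n + w + e + w * e

def W0 (ξ ω : ℂ) : Matrix (Fin 4) (Fin 4) ℂ :=
  !![1, 1, 0, 0; 0, 0, 0, 0; ξ, ξ, 0, 0; 0, 0, 0, 0]

def W1 (ξ ω : ℂ) : Matrix (Fin 4) (Fin 4) ℂ :=
  !![0, 0, 0, 0; 0, 0, ξ, 1; 0, 0, 0, 0; 0, 0, 1, ω]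

/-- The ℤ₂-indexed family `𝐖 = (W₀, W₁)`. -/
def Wf (ξ ω : ℂ) : ZMod 2 → Matrix (Fin 4) (Fin 4) ℂ :=
  fun s => if s = 0 then W0 ξ ω else W1 ξ ω

/-- `𝐖'_s(ξ,ω) = 𝐖_s(ω,ξ)`. -/
def Wf' (ξ ω : ℂ) : ZMod 2 → Matrix (Fin 4) (Fin 4) ℂ := Wf ω ξ

def Smat : Matrix (Fin 4) (Fin 4) ℂ :=
  !![0, 1, 0, 0; 1, 0, 0, 0; 0, 0, 0, 1; 0, 0, 1, 0]

/-- Weyl basis matrices `e_{ij} = |i⟩⟨j|`. -/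
def e11 : Matrix (Fin 2) (Fin 2) ℂ := !![1, 0; 0, 0]
def e12 : Matrix (Fin 2) (Fin 2) ℂ := !![0, 1; 0, 0]
def e22 : Matrix (Fin 2) (Fin 2) ℂ := !![0, 0; 0, 1]

/-- Explicit deformation matrices of the first-orbital representation. -/
def Fp (ξ ω z : ℂ) : Matrix (Fin 4) (Fin 4) ℂ :=
  !![0, 0, 0, 0;
     0, 0, 0, z;
     0, 0, (ξ * ω - 1) / (ω * z ^ 2), 0;
     0, 0, 0, ξ * z ^ 2]

def Fm (ξ ω z : ℂ) : Matrix (Fin 4) (Fin 4) ℂ :=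
  !![0, 0, 0, 0;
     0, 0, 0, 1 / (ξ ^ 2 * z ^ 3);
     0, 0, (ξ * ω - 1) / (ξ * z ^ 2), 0;
     0, 0, 0, ω + (1 / ξ) * (1 / z ^ 2 - 1)]

def Fp' (ξ ω z : ℂ) : Matrix (Fin 4) (Fin 4) ℂ :=
  !![0, 0, 0, 0;
     0, 0, 0, z ^ 3 / ω ^ 2;
     0, 0, z ^ 2 * (ξ * ω - 1) / ω, 0;
     0, 0, 0, ξ + (z ^ 2 - 1) / ω]

def Fm' (ξ ω z : ℂ) : Matrix (Fin 4) (Fin 4) ℂ :=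
  !![0, 0, 0, 0;
     0, 0, 0, 1 / z;
     0, 0, z ^ 2 * (ξ * ω - 1) / ξ, 0;
     0, 0, 0, ω / z ^ 2]

def Gp (ξ ω z : ℂ) : Matrix (Fin 4) (Fin 4) ℂ :=
  !![0, 0, 0, 0;
     0, 0, 0, 0;
     ξ ^ 2, 0, 0, 0;
     -(2 * ξ / z), -1, 0, 0]

def Gm (ξ ω z : ℂ) : Matrix (Fin 4) (Fin 4) ℂ :=
  !![0, 0, 0, 0;
     0, 0, 0, 0;
     ξ * ω, 0, 0, 0;
     -((ξ * ω * z ^ 2 + 1) / (ξ * z ^ 3)), -(ω / (ξ * z ^ 2)), 0, 0]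

def Gp' (ξ ω z : ℂ) : Matrix (Fin 4) (Fin 4) ℂ :=
  !![0, 0, 0, 0;
     0, 0, 0, 0;
     ξ * ω, 0, 0, 0;
     -(z ^ 3 * (ξ / z ^ 2 + 1 / ω)), -(ξ * z ^ 2 / ω), 0, 0]

def Gm' (ξ ω z : ℂ) : Matrix (Fin 4) (Fin 4) ℂ :=
  !![0, 0, 0, 0;
     0, 0, 0, 0;
     ω ^ 2, 0, 0, 0;
     -(2 * ω * z), -1, 0, 0]

def Kp (ξ ω z : ℂ) : Matrix (Fin 4) (Fin 4) ℂ :=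
  !![0, 0, 0, 0;
     0, ξ * z ^ 2, 0, 0;
     0, 0, z ^ 2 * (ξ * ω - 1) / ω, 0;
     0, z, 0, 0]

def Km (ξ ω z : ℂ) : Matrix (Fin 4) (Fin 4) ℂ :=
  !![0, 0, 0, 0;
     0, ω + (1 / ξ) * (1 / z ^ 2 - 1), 0, 0;
     0, 0, z ^ 2 * (ξ * ω - 1) / ξ, 0;
     0, 1 / (ξ ^ 2 * z ^ 3), 0, 0]

def Lp (ξ ω z : ℂ) : Matrix (Fin 4) (Fin 4) ℂ :=
  !![0, 0, 0, 0;
     0, ξ, 0, -z;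
     ξ * ω / z, 0, 0, 0;
     0, 0, -((ξ * ω + z ^ 2) / (ω ^ 2 * z)), -(z ^ 2 / ω)]

def Lm (ξ ω z : ℂ) : Matrix (Fin 4) (Fin 4) ℂ :=
  !![0, 0, 0, 0;
     0, 1 / (ξ * z ^ 2), 0, -(ω / (ξ * z));
     0, 0, ω / z ^ 2, 0;
     -(2 * ω), 0, 0, -ω]

/-- `Ŵ_s = e₁₁ ⊗ W_s(ξz, ω/z) + e₂₂ ⊗ W_s(ξ/z, ωz)`. -/
def What (ξ ω z : ℂ) (s : ZMod 2) : Matrix (Fin 2 × Fin 4) (Fin 2 × Fin 4) ℂ :=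
  e11 ⊗ₖ Wf (ξ * z) (ω / z) s + e22 ⊗ₖ Wf (ξ / z) (ω * z) s

/-- `Ŵ'_s = e₁₁ ⊗ W'_s(ξz, ω/z) + e₂₂ ⊗ W'_s(ξ/z, ωz)`. -/
def What' (ξ ω z : ℂ) (s : ZMod 2) : Matrix (Fin 2 × Fin 4) (Fin 2 × Fin 4) ℂ :=
  e11 ⊗ₖ Wf' (ξ * z) (ω / z) s + e22 ⊗ₖ Wf' (ξ / z) (ω * z) s

/-- `Ŝ = 𝟙₂ ⊗ S`. -/
def Shat : Matrix (Fin 2 × Fin 4) (Fin 2 × Fin 4) ℂ :=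
  (1 : Matrix (Fin 2) (Fin 2) ℂ) ⊗ₖ Smat

/-- Generic hat-deformation `𝟙₈ + e₁₂ ⊗ (c₊ z^k A + c₋ z^{−k} B)/(ξω − 1)`. -/
def hat (ξ ω z cp cm : ℂ) (A B : Matrix (Fin 4) (Fin 4) ℂ) (k : ℤ) :
    Matrix (Fin 2 × Fin 4) (Fin 2 × Fin 4) ℂ :=
  1 + e12 ⊗ₖ ((ξ * ω - 1)⁻¹ • ((cp * z ^ k) • A + (cm * z ^ (-k)) • B))

def Fhat (ξ ω z cp cm : ℂ) (k : ℤ) := hat ξ ω z cp cm (Fp ξ ω z) (Fm ξ ω z) k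
def Fhat' (ξ ω z cp cm : ℂ) (k : ℤ) := hat ξ ω z cp cm (Fp' ξ ω z) (Fm' ξ ω z) k
def Ghat (ξ ω z cp cm : ℂ) (k : ℤ) := hat ξ ω z cp cm (Gp ξ ω z) (Gm ξ ω z) k
def Ghat' (ξ ω z cp cm : ℂ) (k : ℤ) := hat ξ ω z cp cm (Gp' ξ ω z) (Gm' ξ ω z) k
def Khat (ξ ω z cp cm : ℂ) (k : ℤ) := hat ξ ω z cp cm (Kp ξ ω z) (Km ξ ω z) k

/-- `L̂^{(k)} = (z e₁₁ + z⁻¹ e₂₂) ⊗ 𝟙₄ + e₁₂ ⊗ (c₊ z^k L₊ + c₋ z^{−k} L₋)/(ξω−1)`. -/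
def Lhat (ξ ω z cp cm : ℂ) (k : ℤ) : Matrix (Fin 2 × Fin 4) (Fin 2 × Fin 4) ℂ :=
  (z • e11 + z⁻¹ • e22) ⊗ₖ (1 : Matrix (Fin 4) (Fin 4) ℂ)
    + e12 ⊗ₖ ((ξ * ω - 1)⁻¹ • ((cp * z ^ k) • Lp ξ ω z + (cm * z ^ (-k)) • Lm ξ ω z))

def bl (A B D : Matrix (Fin 4) (Fin 4) ℂ) : Matrix (Fin 2 × Fin 4) (Fin 2 × Fin 4) ℂ :=
  e11 ⊗ₖ A + e12 ⊗ₖ B + e22 ⊗ₖ D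

theorem bl_mul (A B D A' B' D' : Matrix (Fin 4) (Fin 4) ℂ) :
    bl A B D * bl A' B' D' = bl (A * A') (A * B' + B * D') (D * D') := by
  have h1 : e11 * e11 = e11 := by ext i j; fin_cases i <;> fin_cases j <;> simp [e11]
  have h2 : e11 * e12 = e12 := by ext i j; fin_cases i <;> fin_cases j <;> simp [e11, e12]
  have h3 : e11 * e22 = 0 := by ext i j; fin_cases i <;> fin_cases j <;> simp [e11, e22]
  have h4 : e12 * e11 = 0 := by ext i j; fin_cases i <;> fin_cases j <;> simp [e11, e12]
  have h5 : e12 * e12 = 0 := by ext i j; fin_cases i <;> fin_cases j <;> simp [e12]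
  have h6 : e12 * e22 = e12 := by ext i j; fin_cases i <;> fin_cases j <;> simp [e12, e22]
  have h7 : e22 * e11 = 0 := by ext i j; fin_cases i <;> fin_cases j <;> simp [e11, e22]
  have h8 : e22 * e12 = 0 := by ext i j; fin_cases i <;> fin_cases j <;> simp [e12, e22]
  have h9 : e22 * e22 = e22 := by ext i j; fin_cases i <;> fin_cases j <;> simp [e22]
  simp only [bl, mul_add, add_mul, ← Matrix.mul_kronecker_mul, h1, h2, h3, h4, h5, h6, h7, h8, h9,
    Matrix.zero_kronecker, Matrix.kronecker_add]
  abel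

theorem e_one : (1 : Matrix (Fin 2) (Fin 2) ℂ) = e11 + e22 := by
  ext i j; fin_cases i <;> fin_cases j <;> simp [e11, e22]

theorem hat_bl (ξ ω z cp cm : ℂ) (A B : Matrix (Fin 4) (Fin 4) ℂ) (k : ℤ) :
    hat ξ ω z cp cm A B k =
      bl 1 ((ξ * ω - 1)⁻¹ • ((cp * z ^ k) • A + (cm * z ^ (-k)) • B)) 1 := by
  rw [hat, bl, ← Matrix.one_kronecker_one, e_one, Matrix.add_kronecker]
  abel

theorem Lhat_bl (ξ ω z cp cm : ℂ) (k : ℤ) :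
    Lhat ξ ω z cp cm k =
      bl (z • 1) ((ξ * ω - 1)⁻¹ • ((cp * z ^ k) • Lp ξ ω z + (cm * z ^ (-k)) • Lm ξ ω z))
        (z⁻¹ • 1) := by
  rw [Lhat, bl, Matrix.add_kronecker, Matrix.smul_kronecker, Matrix.smul_kronecker,
    Matrix.kronecker_smul z e11, Matrix.kronecker_smul z⁻¹ e22]
  abel

theorem Shat_bl : Shat = bl Smat 0 Smat := by
  rw [Shat, bl, e_one, Matrix.add_kronecker]; simp

theorem What_bl (ξ ω z : ℂ) (s : ZMod 2) :
    What ξ ω z s = bl (Wf (ξ * z) (ω / z) s) 0 (Wf (ξ / z) (ω * z) s) := by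
  simp [What, bl]

theorem What'_bl (ξ ω z : ℂ) (s : ZMod 2) :
    What' ξ ω z s = bl (Wf (ω / z) (ξ * z) s) 0 (Wf (ω * z) (ξ / z) s) := by
  simp [What', Wf', bl]

theorem Wf_zero (ξ ω : ℂ) : Wf ξ ω 0 = W0 ξ ω := by simp [Wf]
theorem Wf_one (ξ ω : ℂ) : Wf ξ ω 1 = W1 ξ ω := by simp [Wf]


theorem lit_mul (a b c d e f g h i j k l m n o p a' b' c' d' e' f' g' h' i' j' k' l' m' n' o' p' : ℂ) :
    (!![a, b, c, d; e, f, g, h; i, j, k, l; m, n, o, p] : Matrix (Fin 4) (Fin 4) ℂ) *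
      !![a', b', c', d'; e', f', g', h'; i', j', k', l'; m', n', o', p'] =
    !![a*a'+b*e'+c*i'+d*m', a*b'+b*f'+c*j'+d*n', a*c'+b*g'+c*k'+d*o', a*d'+b*h'+c*l'+d*p';
       e*a'+f*e'+g*i'+h*m', e*b'+f*f'+g*j'+h*n', e*c'+f*g'+g*k'+h*o', e*d'+f*h'+g*l'+h*p';
       i*a'+j*e'+k*i'+l*m', i*b'+j*f'+k*j'+l*n', i*c'+j*g'+k*k'+l*o', i*d'+j*h'+k*l'+l*p';
       m*a'+n*e'+o*i'+p*m', m*b'+n*f'+o*j'+p*n', m*c'+n*g'+o*k'+p*o', m*d'+n*h'+o*l'+p*p'] := by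
  ext x y; fin_cases x <;> fin_cases y <;> simp [Matrix.mul_apply, Fin.sum_univ_succ] <;> ring

theorem lit_add (a b c d e f g h i j k l m n o p a' b' c' d' e' f' g' h' i' j' k' l' m' n' o' p' : ℂ) :
    (!![a, b, c, d; e, f, g, h; i, j, k, l; m, n, o, p] : Matrix (Fin 4) (Fin 4) ℂ) +
      !![a', b', c', d'; e', f', g', h'; i', j', k', l'; m', n', o', p'] =
    !![a+a', b+b', c+c', d+d'; e+e', f+f', g+g', h+h'; i+i', j+j', k+k', l+l';
       m+m', n+n', o+o', p+p'] := by
  ext x y; fin_cases x <;> fin_cases y <;> rfl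

theorem lit_smul (t a b c d e f g h i j k l m n o p : ℂ) :
    t • (!![a, b, c, d; e, f, g, h; i, j, k, l; m, n, o, p] : Matrix (Fin 4) (Fin 4) ℂ) =
    !![t*a, t*b, t*c, t*d; t*e, t*f, t*g, t*h; t*i, t*j, t*k, t*l; t*m, t*n, t*o, t*p] := by
  ext x y; fin_cases x <;> fin_cases y <;> rfl

theorem lit_ext {a b c d e f g h i j k l m n o p a' b' c' d' e' f' g' h' i' j' k' l' m' n' o' p' : ℂ}
    (h1 : a = a') (h2 : b = b') (h3 : c = c') (h4 : d = d') (h5 : e = e') (h6 : f = f')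
    (h7 : g = g') (h8 : h = h') (h9 : i = i') (h10 : j = j') (h11 : k = k') (h12 : l = l')
    (h13 : m = m') (h14 : n = n') (h15 : o = o') (h16 : p = p') :
    (!![a, b, c, d; e, f, g, h; i, j, k, l; m, n, o, p] : Matrix (Fin 4) (Fin 4) ℂ) =
      !![a', b', c', d'; e', f', g', h'; i', j', k', l'; m', n', o', p'] := by
  subst_vars; rfl

theorem zmod2 (x : ZMod 2) : x = 0 ∨ x = 1 := by revert x; decide
theorem c1 : chi 0 0 0 = 0 := by decide
theorem c2 : chi 0 0 1 = 1 := by decide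
theorem c3 : chi 0 1 0 = 1 := by decide
theorem c4 : chi 0 1 1 = 0 := by decide
theorem c5 : chi 1 0 0 = 1 := by decide
theorem c6 : chi 1 0 1 = 1 := by decide
theorem c7 : chi 1 1 0 = 0 := by decide
theorem c8 : chi 1 1 1 = 0 := by decide

set_option maxHeartbeats 2000000 in
theorem diag1 (a b : ℂ) (s s' s'' : ZMod 2) :
    Wf a b s * Smat * Wf a b (chi s s' s'') * Wf b a s'' =
    Wf a b s * Wf b a s' * Wf a b s'' * Smat := by
  rcases zmod2 s with rfl | rfl <;> rcases zmod2 s' with rfl | rfl <;>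
    rcases zmod2 s'' with rfl | rfl <;>
    simp only [c1, c2, c3, c4, c5, c6, c7, c8, Wf_zero, Wf_one, W0, W1, Smat, lit_mul,
      mul_zero, zero_mul, add_zero, zero_add, mul_one, one_mul] <;>
    apply lit_ext <;> ring

set_option maxHeartbeats 2000000 in
theorem diag2 (a b : ℂ) (s s' s'' : ZMod 2) :
    Wf b a s * Wf a b (chi s s' s'') * Wf b a s'' * Smat =
    Wf b a s * Smat * Wf b a s' * Wf a b s'' := by
  rcases zmod2 s with rfl | rfl <;> rcases zmod2 s' with rfl | rfl <;>
    rcases zmod2 s'' with rfl | rfl <;>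
    simp only [c1, c2, c3, c4, c5, c6, c7, c8, Wf_zero, Wf_one, W0, W1, Smat, lit_mul,
      mul_zero, zero_mul, add_zero, zero_add, mul_one, one_mul] <;>
    apply lit_ext <;> ring

theorem coefs (ξ ω z cp cm : ℂ) (hz : z ≠ 0) (k : ℤ) : ∃ u v : ℂ,
    ∀ A B : Matrix (Fin 4) (Fin 4) ℂ,
    ((ξ * ω - 1)⁻¹ • ((cp * z ^ k) • A + (cm * z ^ (-k)) • B)) = u • A + v • B ∧
    ((ξ * ω - 1)⁻¹ • ((cp * z ^ (k - 1)) • A + (cm * z ^ (-(k - 1))) • B))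
      = (u / z) • A + (v * z) • B ∧
    ((ξ * ω - 1)⁻¹ • ((cp * z ^ (k + 1)) • A + (cm * z ^ (-(k + 1))) • B))
      = (u * z) • A + (v / z) • B := by
  refine ⟨(ξ * ω - 1)⁻¹ * (cp * z ^ k), (ξ * ω - 1)⁻¹ * (cm * z ^ (-k)), fun A B => ⟨?_, ?_, ?_⟩⟩
  · rw [smul_add, smul_smul, smul_smul]
  · rw [smul_add, smul_smul, smul_smul, neg_sub, sub_eq_add_neg 1 k, add_comm 1 (-k),
      zpow_sub_one₀ hz, zpow_add_one₀ hz]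
    congr 2 <;> ring
  · rw [smul_add, smul_smul, smul_smul, neg_add, ← sub_eq_add_neg,
      zpow_sub_one₀ hz, zpow_add_one₀ hz]
    congr 2 <;> ring

set_option maxHeartbeats 8000000 in
theorem off1 (ξ ω z u v : ℂ) (hξ : ξ ≠ 0) (hω : ω ≠ 0) (hz : z ≠ 0) (s s' s'' : ZMod 2) :
    ((Wf (ξ * z) (ω / z) s * Smat * Wf (ξ * z) (ω / z) (chi s s' s'') * ((u * z) • Fp ξ ω z + (v / z) • Fm ξ ω z) +
            (Wf (ξ * z) (ω / z) s * Smat * (u • Gp ξ ω z + v • Gm ξ ω z) +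
                ((u / z) • Kp ξ ω z + (v * z) • Km ξ ω z) * Wf (ξ / z) (ω * z) s * Smat) *
              Wf (ξ / z) (ω * z) (chi s s' s'')) *
          Wf (ω * z) (ξ / z) s'') =
        ((Wf (ξ * z) (ω / z) s * Wf (ω / z) (ξ * z) s' * ((u * z) • Kp ξ ω z + (v / z) • Km ξ ω z) +
              (Wf (ξ * z) (ω / z) s * (u • Gp' ξ ω z + v • Gm' ξ ω z) +
                  ((u / z) • Fp' ξ ω z + (v * z) • Fm' ξ ω z) * Wf (ξ / z) (ω * z) s) *
                Wf (ω * z) (ξ / z) s') *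
            Wf (ξ / z) (ω * z) s'' *
          Smat) := by
  rcases zmod2 s with rfl | rfl <;> rcases zmod2 s' with rfl | rfl <;>
    rcases zmod2 s'' with rfl | rfl <;>
    simp only [c1, c2, c3, c4, c5, c6, c7, c8, Wf_zero, Wf_one, W0, W1, Smat, Fp, Fm, Fp', Fm',
      Gp, Gm, Gp', Gm', Kp, Km, Lp, Lm, lit_mul, lit_add, lit_smul,
      mul_zero, zero_mul, add_zero, zero_add, mul_one, one_mul] <;>
    apply lit_ext <;> first | rfl | ring1 | (field_simp; done) | (field_simp; ring1)

set_option maxHeartbeats 8000000 in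
theorem off2 (ξ ω z u v : ℂ) (hξ : ξ ≠ 0) (hω : ω ≠ 0) (hz : z ≠ 0) (s s' s'' : ZMod 2) :
        ((Wf (ω / z) (ξ * z) s * Wf (ξ * z) (ω / z) (chi s s' s'') * ((u * z) • Lp ξ ω z + (v / z) • Lm ξ ω z) +
              z⁻¹ •
                ((Wf (ω / z) (ξ * z) s * (u • Fp' ξ ω z + v • Fm' ξ ω z) +
                    ((u / z) • Gp' ξ ω z + (v * z) • Gm' ξ ω z) * Wf (ω * z) (ξ / z) s) *
                  Wf (ξ / z) (ω * z) (chi s s' s''))) *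
            Wf (ω * z) (ξ / z) s'' *
          Smat) =
        ((z • (Wf (ω / z) (ξ * z) s * Smat * Wf (ω / z) (ξ * z) s' * ((u * z) • Gp ξ ω z + (v / z) • Gm ξ ω z)) +
            (z • (Wf (ω / z) (ξ * z) s * Smat * (u • Fp ξ ω z + v • Fm ξ ω z)) +
                ((u / z) • Lp ξ ω z + (v * z) • Lm ξ ω z) * Wf (ω * z) (ξ / z) s * Smat) *
              Wf (ω * z) (ξ / z) s') *
          Wf (ξ / z) (ω * z) s'') := by
  rcases zmod2 s with rfl | rfl <;> rcases zmod2 s' with rfl | rfl <;>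
    rcases zmod2 s'' with rfl | rfl <;>
    simp only [c1, c2, c3, c4, c5, c6, c7, c8, Wf_zero, Wf_one, W0, W1, Smat, Fp, Fm, Fp', Fm',
      Gp, Gm, Gp', Gm', Kp, Km, Lp, Lm, lit_mul, lit_add, lit_smul,
      mul_zero, zero_mul, add_zero, zero_add, mul_one, one_mul] <;>
    apply lit_ext <;> first | rfl | ring1 | (field_simp; done) | (field_simp; ring1)

/-- The deformed bulk cancellation relations of the first orbital. -/
theorem rule54_deformed_bulk_relations
    (ξ ω z cp cm : ℂ) (hξ : ξ ≠ 0) (hω : ω ≠ 0) (hz : z ≠ 0) (hξω : ξ * ω ≠ 1) :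
    ∀ (k : ℤ) (s s' s'' : ZMod 2),
      (Khat ξ ω z cp cm (k - 1) * What ξ ω z s * Shat * Ghat ξ ω z cp cm k
          * What ξ ω z (chi s s' s'') * Fhat ξ ω z cp cm (k + 1) * What' ξ ω z s''
        = Fhat' ξ ω z cp cm (k - 1) * What ξ ω z s * Ghat' ξ ω z cp cm k
          * What' ξ ω z s' * Khat ξ ω z cp cm (k + 1) * What ξ ω z s'' * Shat) ∧
      (Ghat' ξ ω z cp cm (k - 1) * What' ξ ω z s * Fhat' ξ ω z cp cm k
          * What ξ ω z (chi s s' s'') * Lhat ξ ω z cp cm (k + 1) * What' ξ ω z s'' * Shat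
        = Lhat ξ ω z cp cm (k - 1) * What' ξ ω z s * Shat * Fhat ξ ω z cp cm k
          * What' ξ ω z s' * Ghat ξ ω z cp cm (k + 1) * What ξ ω z s'') := by
  intro k s s' s''
  obtain ⟨u, v, huv⟩ := coefs ξ ω z cp cm hz k
  simp only [Khat, Fhat, Fhat', Ghat, Ghat', hat_bl, Lhat_bl, What_bl, What'_bl, Shat_bl,
    (huv _ _).1, (huv _ _).2.1, (huv _ _).2.2, bl_mul, mul_zero, zero_mul, add_zero, zero_add,
    mul_one, one_mul, smul_mul_assoc, mul_smul_comm]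
  exact ⟨by rw [diag1, diag1, off1 ξ ω z u v hξ hω hz],
    by rw [diag2, diag2, off2 ξ ω z u v hξ hω hz]⟩

end
end
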